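/- arXiv:2405.07252 — 2 statements merged into one kernel-verified Lean document; each statement's English description precedes it below -/
import Mathlib

section
/- (Lemma 1) For all priors π_0 and π_1 on F and all λ in [0,1], J(λ π_1 + (1−λ) π_0) ≤ λ J(π_1) + (1−λ) J(π_0) + h(λ), where h(λ) = −λ log λ − (1−λ) log(1−λ) is the binary entropy (with h(0) = h(1) = 0). -/
noncomputable section

/-- A model: a strictly positive probability function on `Y^(n+1)`. -/
def IsModel {Y : Type*} [Fintype Y] {n : ℕ} (P : (Fin (n + 1) → Y) → ℝ) : Prop :=
  (∀ y, 0 < P y) ∧ (∑ y, P y) = 1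

/-- A predictor: to every prefix `y^{N-1}` it assigns a strictly positive
probability function on `Y`. -/
def IsPredictor {Y : Type*} [Fintype Y] {n : ℕ} (Q : (Fin n → Y) → Y → ℝ) : Prop :=
  ∀ z, (∀ y, 0 < Q z y) ∧ (∑ y, Q z y) = 1

/-- Marginal probability `P(y^{N-1}) = Σ_y P(y^{N-1}, y)` of a prefix. -/
def prefixProb {Y : Type*} [Fintype Y] {n : ℕ} (P : (Fin (n + 1) → Y) → ℝ)
    (z : Fin n → Y) : ℝ :=
  ∑ y : Y, P (Fin.snoc z y)

/-- Conditional probability `P(y_N | y^{N-1}) = P(y^N) / P(y^{N-1})`. -/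
def condProb {Y : Type*} [Fintype Y] {n : ℕ} (P : (Fin (n + 1) → Y) → ℝ)
    (y : Fin (n + 1) → Y) : ℝ :=
  P y / prefixProb P (Fin.init y)

/-- The regret
`R_N(Pφ, Pθ, Q) = Σ_{y^N} Pφ(y^N) log( Pθ(y_N|y^{N-1}) / Q(y_N|y^{N-1}) )`. -/
def regretN {Y : Type*} [Fintype Y] {n : ℕ} (Pφ Pθ : (Fin (n + 1) → Y) → ℝ)
    (Q : (Fin n → Y) → Y → ℝ) : ℝ :=
  ∑ y, Pφ y * Real.log (condProb Pθ y / Q (Fin.init y) (y (Fin.last n)))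

/-- Conditional KL divergence of a model `P` from a predictor `Q`. -/
def DcPred {Y : Type*} [Fintype Y] {n : ℕ} (P : (Fin (n + 1) → Y) → ℝ)
    (Q : (Fin n → Y) → Y → ℝ) : ℝ :=
  ∑ y, P y * Real.log (condProb P y / Q (Fin.init y) (y (Fin.last n)))

/-- Conditional KL divergence of a model `P` from another model `P'`. -/
def DcModel {Y : Type*} [Fintype Y] {n : ℕ} (P P' : (Fin (n + 1) → Y) → ℝ) : ℝ :=
  ∑ y, P y * Real.log (condProb P y / condProb P' y)

/-- A prior: a probability vector on the index set `F`. -/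
def IsPrior {F : Type*} [Fintype F] (π : F → ℝ) : Prop :=
  (∀ φ, 0 ≤ π φ) ∧ (∑ φ, π φ) = 1

/-- Conditional divergence of a model from the hypothesis class
`Θ = {P θ : θ ∈ G}`: the minimum over `θ ∈ G` of `D_{c,N}(P ‖ P θ)`. -/
def DcSet {Y F : Type*} [Fintype Y] [Fintype F] {n : ℕ}
    (P : F → (Fin (n + 1) → Y) → ℝ) (G : Finset F) (hG : G.Nonempty)
    (Pφ : (Fin (n + 1) → Y) → ℝ) : ℝ :=
  G.inf' hG fun θ => DcModel Pφ (P θ)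

/-- The mixture predictor
`Q_π(y_N | y^{N-1}) = (Σ_φ π(φ) P_φ(y^N)) / (Σ_φ π(φ) P_φ(y^{N-1}))`. -/
def mixPred {Y F : Type*} [Fintype Y] [Fintype F] {n : ℕ}
    (P : F → (Fin (n + 1) → Y) → ℝ) (π : F → ℝ) : (Fin n → Y) → Y → ℝ :=
  fun z y => (∑ φ, π φ * P φ (Fin.snoc z y)) / (∑ φ, π φ * prefixProb (P φ) z)

/-- `I_π(Y_N; Φ | Y^{N-1})`. -/
def mutualInfoN {Y F : Type*} [Fintype Y] [Fintype F] {n : ℕ}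
    (P : F → (Fin (n + 1) → Y) → ℝ) (π : F → ℝ) : ℝ :=
  ∑ φ, ∑ y, π φ * P φ y *
    Real.log (condProb (P φ) y / mixPred P π (Fin.init y) (y (Fin.last n)))

/-- `J(π) = I_π(Y_N; Φ | Y^{N-1}) − Σ_φ π(φ) D_{c,N}(P_φ ‖ Θ)`. -/
def Jfun {Y F : Type*} [Fintype Y] [Fintype F] {n : ℕ}
    (P : F → (Fin (n + 1) → Y) → ℝ) (G : Finset F) (hG : G.Nonempty)
    (π : F → ℝ) : ℝ :=
  mutualInfoN P π - ∑ φ, π φ * DcSet P G hG (P φ)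

/-- The min-max regret
`R*_N(Θ, Φ) = inf_Q max_{φ ∈ F} max_{θ ∈ G} R_N(P_φ, P_θ, Q)`. -/
def Rstar {Y F : Type*} [Fintype Y] [Fintype F] [Nonempty F] {n : ℕ}
    (P : F → (Fin (n + 1) → Y) → ℝ) (G : Finset F) (hG : G.Nonempty) : ℝ :=
  sInf {r : ℝ | ∃ Q, IsPredictor Q ∧
    r = Finset.univ.sup' Finset.univ_nonempty fun φ =>
          G.sup' hG fun θ => regretN (P φ) (P θ) Q}

/-- The conditional capacity `C_{c,N}(Φ) = sup_π I_π(Y_N; Φ | Y^{N-1})`. -/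
def capacityN {Y F : Type*} [Fintype Y] [Fintype F] {n : ℕ}
    (P : F → (Fin (n + 1) → Y) → ℝ) : ℝ :=
  sSup {r : ℝ | ∃ π, IsPrior π ∧ r = mutualInfoN P π}

/-- The binary entropy `h(λ) = −λ log λ − (1−λ) log(1−λ)`
(with `h(0) = h(1) = 0`, using `Real.log 0 = 0`). -/
def binEnt (l : ℝ) : ℝ := -(l * Real.log l) - (1 - l) * Real.log (1 - l)

section Helpers

variable {Y F : Type*} [Fintype F] {n : ℕ}

/-- The mixture `Σ_φ π(φ) P_φ` of a family of models. -/
def mixture (P : F → (Fin (n + 1) → Y) → ℝ) (π : F → ℝ) (y : Fin (n + 1) → Y) : ℝ :=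
  ∑ φ, π φ * P φ y

theorem mixture_convexCombination (P : F → (Fin (n + 1) → Y) → ℝ) (π0 π1 : F → ℝ) (l : ℝ)
    (y : Fin (n + 1) → Y) :
    mixture P (fun φ => l * π1 φ + (1 - l) * π0 φ) y =
      l * mixture P π1 y + (1 - l) * mixture P π0 y := by
  simp only [mixture, Finset.mul_sum, ← Finset.sum_add_distrib]
  exact Finset.sum_congr rfl fun φ _ => by ring

variable [Fintype Y]

theorem sum_eq_sum_snoc (f : (Fin (n + 1) → Y) → ℝ) :
    ∑ y, f y = ∑ z : Fin n → Y, ∑ a : Y, f (Fin.snoc z a) := by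
  rw [← (Fin.snocEquiv fun _ => Y).sum_comp, Fintype.sum_prod_type, Finset.sum_comm]
  rfl

theorem sum_prefixProb (P : (Fin (n + 1) → Y) → ℝ) :
    ∑ z, prefixProb P z = ∑ y, P y :=
  (sum_eq_sum_snoc P).symm

theorem prefixProb_init_pos {P : (Fin (n + 1) → Y) → ℝ} (hP : ∀ y, 0 < P y)
    (y : Fin (n + 1) → Y) : 0 < prefixProb P (Fin.init y) :=
  Finset.sum_pos (fun _ _ => hP _) ⟨y (Fin.last n), Finset.mem_univ _⟩

theorem condProb_pos {P : (Fin (n + 1) → Y) → ℝ} (hP : ∀ y, 0 < P y)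
    (y : Fin (n + 1) → Y) : 0 < condProb P y :=
  div_pos (hP y) (prefixProb_init_pos hP y)

theorem IsModel.mixture {P : F → (Fin (n + 1) → Y) → ℝ} (hP : ∀ φ, IsModel (P φ))
    {π : F → ℝ} (hπ : IsPrior π) : IsModel (mixture P π) := by
  constructor
  · intro y
    obtain ⟨φ, hφ⟩ : ∃ φ, π φ ≠ 0 := by
      by_contra! h
      simpa [h] using hπ.2
    exact Finset.sum_pos' (fun ψ _ => mul_nonneg (hπ.1 ψ) ((hP ψ).1 y).le)
      ⟨φ, Finset.mem_univ _, mul_pos ((hπ.1 φ).lt_of_ne' hφ) ((hP φ).1 y)⟩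
  · simp only [_root_.mixture]
    rw [Finset.sum_comm]
    simp only [← Finset.mul_sum, (hP _).2, mul_one, hπ.2]

theorem IsPrior.convexCombination {π0 π1 : F → ℝ} (hπ0 : IsPrior π0) (hπ1 : IsPrior π1)
    {l : ℝ} (hl0 : 0 ≤ l) (hl1 : l ≤ 1) :
    IsPrior fun φ => l * π1 φ + (1 - l) * π0 φ := by
  constructor
  · intro φ
    exact add_nonneg (mul_nonneg hl0 (hπ1.1 φ)) (mul_nonneg (sub_nonneg.2 hl1) (hπ0.1 φ))
  · simp [Finset.sum_add_distrib, ← Finset.mul_sum, hπ0.2, hπ1.2]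

theorem mixPred_eq_condProb_mixture (P : F → (Fin (n + 1) → Y) → ℝ) (π : F → ℝ)
    (y : Fin (n + 1) → Y) :
    mixPred P π (Fin.init y) (y (Fin.last n)) = condProb (mixture P π) y := by
  simp only [mixPred, condProb, prefixProb, mixture, Fin.snoc_init_self, Finset.mul_sum]
  rw [Finset.sum_comm]

/-- The conditional mutual information is a difference of (negative) conditional entropies. -/
theorem mutualInfoN_eq_sub {P : F → (Fin (n + 1) → Y) → ℝ} (hP : ∀ φ, IsModel (P φ))
    {π : F → ℝ} (hπ : IsPrior π) :
    mutualInfoN P π = (∑ φ, π φ * ∑ y, P φ y * Real.log (condProb (P φ) y)) -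
      ∑ y, mixture P π y * Real.log (condProb (mixture P π) y) := by
  have hlog (φ : F) (y : Fin (n + 1) → Y) :
      Real.log (condProb (P φ) y / condProb (mixture P π) y) =
        Real.log (condProb (P φ) y) - Real.log (condProb (mixture P π) y) :=
    Real.log_div (condProb_pos (hP φ).1 y).ne' (condProb_pos (IsModel.mixture hP hπ).1 y).ne'
  have hmix : ∑ y, mixture P π y * Real.log (condProb (mixture P π) y) =
      ∑ φ, ∑ y, π φ * P φ y * Real.log (condProb (mixture P π) y) := by
    rw [Finset.sum_comm]
    simp only [← Finset.sum_mul]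
    rfl
  simp only [mutualInfoN, mixPred_eq_condProb_mixture, hlog, mul_sub, Finset.sum_sub_distrib,
    hmix, Finset.mul_sum, mul_assoc]

theorem DcModel_eq_sub {M M' : (Fin (n + 1) → Y) → ℝ} (hM : ∀ y, 0 < M y)
    (hM' : ∀ y, 0 < M' y) :
    DcModel M M' =
      ∑ y, M y * Real.log (condProb M y) - ∑ y, M y * Real.log (condProb M' y) := by
  rw [DcModel, ← Finset.sum_sub_distrib]
  refine Finset.sum_congr rfl fun y _ => ?_
  rw [Real.log_div (condProb_pos hM y).ne' (condProb_pos hM' y).ne', mul_sub]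

/-- If `M'` dominates `l * M`, the conditional divergence of `M` from `M'` is at most `-log l`. -/
theorem DcModel_le_neg_log {M M' : (Fin (n + 1) → Y) → ℝ} (hM : IsModel M) (hM' : IsModel M')
    {l : ℝ} (hl : 0 < l) (hle : ∀ y, l * M y ≤ M' y) : DcModel M M' ≤ -Real.log l := by
  have hpoint (y : Fin (n + 1) → Y) :
      M y * Real.log (condProb M y / condProb M' y) ≤
        M y * (-Real.log l - 1) +
          M y * (prefixProb M' (Fin.init y) / prefixProb M (Fin.init y)) := by
    have hm := prefixProb_init_pos hM.1 y
    have hm' := prefixProb_init_pos hM'.1 y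
    have hratio : condProb M y / condProb M' y =
        M y / M' y * (prefixProb M' (Fin.init y) / prefixProb M (Fin.init y)) := by
      rw [condProb, condProb, div_div_div_eq, div_mul_div_comm, mul_comm (M' y)]
    have hlog : Real.log (M y / M' y) ≤ -Real.log l := by
      rw [← Real.log_inv]
      refine Real.log_le_log (div_pos (hM.1 y) (hM'.1 y)) ?_
      rw [div_le_iff₀ (hM'.1 y), inv_mul_eq_div, le_div_iff₀ hl, mul_comm]
      exact hle y
    rw [hratio, Real.log_mul (div_pos (hM.1 y) (hM'.1 y)).ne' (div_pos hm' hm).ne', ← mul_add]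
    refine mul_le_mul_of_nonneg_left ?_ (hM.1 y).le
    linarith [Real.log_le_sub_one_of_pos (div_pos hm' hm)]
  have hprefix :
      ∑ y, M y * (prefixProb M' (Fin.init y) / prefixProb M (Fin.init y)) = 1 := by
    rw [sum_eq_sum_snoc, ← hM'.2, ← sum_prefixProb]
    refine Finset.sum_congr rfl fun z _ => ?_
    simp only [Fin.init_snoc, ← Finset.sum_mul]
    change prefixProb M z * _ = _
    rcases isEmpty_or_nonempty Y with hY | ⟨⟨a⟩⟩
    · simp [prefixProb]
    · have hm := prefixProb_init_pos hM.1 (Fin.snoc (α := fun _ => Y) z a)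
      rw [Fin.init_snoc] at hm
      exact mul_div_cancel₀ _ hm.ne'
  calc DcModel M M' ≤ ∑ y, (M y * (-Real.log l - 1) +
          M y * (prefixProb M' (Fin.init y) / prefixProb M (Fin.init y))) :=
        Finset.sum_le_sum fun y _ => hpoint y
    _ = -Real.log l := by
        rw [Finset.sum_add_distrib, hprefix, ← Finset.sum_mul, hM.2]
        ring

theorem mul_DcModel_le {M M' : (Fin (n + 1) → Y) → ℝ} (hM : IsModel M) (hM' : IsModel M')
    {l : ℝ} (hl : 0 ≤ l) (hle : ∀ y, l * M y ≤ M' y) :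
    l * DcModel M M' ≤ -(l * Real.log l) := by
  rcases hl.eq_or_lt with rfl | hl
  · simp
  · rw [← mul_neg]
    exact mul_le_mul_of_nonneg_left (DcModel_le_neg_log hM hM' hl hle) hl.le

end Helpers

variable {Y F : Type*} [Fintype Y] [Nonempty Y] [Fintype F] [Nonempty F] {n : ℕ}

/-- Lemma 1: near-concavity of `J` up to the binary entropy. -/
theorem J_mixture_le
    (P : F → (Fin (n + 1) → Y) → ℝ) (hP : ∀ φ, IsModel (P φ))
    (G : Finset F) (hG : G.Nonempty)
    (π0 π1 : F → ℝ) (hπ0 : IsPrior π0) (hπ1 : IsPrior π1)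
    (l : ℝ) (hl0 : 0 ≤ l) (hl1 : l ≤ 1) :
    Jfun P G hG (fun φ => l * π1 φ + (1 - l) * π0 φ) ≤
      l * Jfun P G hG π1 + (1 - l) * Jfun P G hG π0 + binEnt l := by
  have hπ := hπ0.convexCombination hπ1 hl0 hl1
  set π : F → ℝ := fun φ => l * π1 φ + (1 - l) * π0 φ with hπdef
  have hM0 := IsModel.mixture hP hπ0
  have hM1 := IsModel.mixture hP hπ1
  have hM := IsModel.mixture hP hπ
  have hmix : ∀ y, mixture P π y = l * mixture P π1 y + (1 - l) * mixture P π0 y :=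
    mixture_convexCombination P π0 π1 l
  have hl1' : 0 ≤ 1 - l := sub_nonneg.2 hl1
  have h1 := mul_DcModel_le hM1 hM hl0 fun y => by
    rw [hmix]
    exact le_add_of_nonneg_right (mul_nonneg hl1' (hM0.1 y).le)
  have h0 := mul_DcModel_le hM0 hM hl1' fun y => by
    rw [hmix]
    exact le_add_of_nonneg_left (mul_nonneg hl0 (hM1.1 y).le)
  rw [DcModel_eq_sub hM1.1 hM.1] at h1
  rw [DcModel_eq_sub hM0.1 hM.1] at h0
  have hlin (c : F → ℝ) :
      ∑ φ, π φ * c φ = l * ∑ φ, π1 φ * c φ + (1 - l) * ∑ φ, π0 φ * c φ := by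
    simp only [hπdef, Finset.mul_sum, ← Finset.sum_add_distrib]
    exact Finset.sum_congr rfl fun φ _ => by ring
  have hent : ∑ y, mixture P π y * Real.log (condProb (mixture P π) y) =
      l * ∑ y, mixture P π1 y * Real.log (condProb (mixture P π) y) +
        (1 - l) * ∑ y, mixture P π0 y * Real.log (condProb (mixture P π) y) := by
    simp only [Finset.mul_sum, ← Finset.sum_add_distrib]
    exact Finset.sum_congr rfl fun y _ => by rw [hmix]; ring
  simp only [Jfun, mutualInfoN_eq_sub hP hπ, mutualInfoN_eq_sub hP hπ0,
    mutualInfoN_eq_sub hP hπ1, binEnt]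
  rw [hlin, hlin, hent]
  linarith
end
end

section
/- (Theorem 2, lower bound) Suppose Θ = {P_φ : φ in G} for a nonempty subset G of F, so Θ ⊆ Φ. Then C_{c,N}(Θ) ≤ R*_N(Θ, Φ), where C_{c,N}(Θ) is the conditional capacity computed as the supremum of I_π(Y_N; Φ | Y^{N-1}) over priors π supported on G. -/
noncomputable section

/-- Summing over sequences is summing over prefixes and last letters. -/
theorem sum_snoc {Y : Type*} [Fintype Y] {n : ℕ} (f : (Fin (n + 1) → Y) → ℝ) :
    ∑ y, f y = ∑ z : Fin n → Y, ∑ a : Y, f (Fin.snoc z a) := by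
  rw [← Fintype.sum_prod_type_right', ← (Fin.snocEquiv fun _ => Y).sum_comp]
  rfl

theorem prefixProb_pos {Y : Type*} [Fintype Y] [Nonempty Y] {n : ℕ}
    {P : (Fin (n + 1) → Y) → ℝ} (hP : ∀ y, 0 < P y) (z : Fin n → Y) :
    0 < prefixProb P z :=
  Finset.sum_pos (fun _ _ => hP _) Finset.univ_nonempty

theorem IsPrior.sum_mul_pos {F : Type*} [Fintype F] {π : F → ℝ} (hπ : IsPrior π)
    {f : F → ℝ} (hf : ∀ φ, 0 < f φ) : 0 < ∑ φ, π φ * f φ := by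
  obtain ⟨φ, -, hφ⟩ : ∃ φ ∈ Finset.univ, π φ ≠ 0 :=
    Finset.exists_ne_zero_of_sum_ne_zero (hπ.2.trans_ne one_ne_zero)
  exact Finset.sum_pos' (fun ψ _ => mul_nonneg (hπ.1 ψ) (hf ψ).le)
    ⟨φ, Finset.mem_univ φ, mul_pos ((hπ.1 φ).lt_of_ne' hφ) (hf φ)⟩

/-- Gibbs' inequality for conditional probabilities: a predictor `Q` has nonnegative
conditional divergence from a positive weight function `M`. -/
theorem regretN_self_nonneg {Y : Type*} [Fintype Y] [Nonempty Y] {n : ℕ}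
    {M : (Fin (n + 1) → Y) → ℝ} (hM : ∀ y, 0 < M y) {Q : (Fin n → Y) → Y → ℝ}
    (hQ : IsPredictor Q) : 0 ≤ regretN M M Q := by
  have key : ∀ y, M y - prefixProb M (Fin.init y) * Q (Fin.init y) (y (Fin.last n)) ≤
      M y * Real.log (condProb M y / Q (Fin.init y) (y (Fin.last n))) := by
    intro y
    have hp := prefixProb_pos hM (Fin.init y)
    have hq := (hQ (Fin.init y)).1 (y (Fin.last n))
    have hy := hM y
    have h := Real.one_sub_inv_le_log_of_pos
      (show 0 < condProb M y / Q (Fin.init y) (y (Fin.last n)) from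
        div_pos (div_pos hy hp) hq)
    refine le_trans (le_of_eq ?_) (mul_le_mul_of_nonneg_left h hy.le)
    rw [condProb]
    field_simp
  refine le_trans (le_of_eq ?_) (Finset.sum_le_sum fun y _ => key y)
  rw [sum_snoc, eq_comm]
  refine Finset.sum_eq_zero fun z _ => ?_
  simp only [Fin.init_snoc, Fin.snoc_last, Finset.sum_sub_distrib, ← Finset.mul_sum,
    (hQ z).2, mul_one]
  exact sub_self _

/-- The mixture predictor is the conditional probability of the mixture. -/
theorem mixPred_init_last {Y F : Type*} [Fintype Y] [Fintype F] {n : ℕ}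
    (P : F → (Fin (n + 1) → Y) → ℝ) (π : F → ℝ) (y : Fin (n + 1) → Y) :
    mixPred P π (Fin.init y) (y (Fin.last n)) = condProb (fun x => ∑ φ, π φ * P φ x) y := by
  simp only [mixPred, condProb, prefixProb, Fin.snoc_init_self, Finset.mul_sum]
  rw [Finset.sum_comm]

/-- The average regret of `Q` exceeds the mutual information by the conditional divergence
of `Q` from the mixture. -/
theorem sum_regretN_eq {Y F : Type*} [Fintype Y] [Nonempty Y] [Fintype F] {n : ℕ}
    {P : F → (Fin (n + 1) → Y) → ℝ} (hP : ∀ φ y, 0 < P φ y) {π : F → ℝ} (hπ : IsPrior π)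
    {Q : (Fin n → Y) → Y → ℝ} (hQ : IsPredictor Q) :
    ∑ φ, π φ * regretN (P φ) (P φ) Q = mutualInfoN P π +
      regretN (fun y => ∑ φ, π φ * P φ y) (fun y => ∑ φ, π φ * P φ y) Q := by
  have hM : ∀ y, 0 < ∑ φ, π φ * P φ y := fun y => hπ.sum_mul_pos fun φ => hP φ y
  simp only [regretN, mutualInfoN, mixPred_init_last, Finset.sum_mul, Finset.mul_sum]
  rw [Finset.sum_comm (f := fun y φ => π φ * P φ y * _), ← Finset.sum_add_distrib]
  refine Finset.sum_congr rfl fun φ _ => ?_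
  rw [← Finset.sum_add_distrib]
  refine Finset.sum_congr rfl fun y _ => ?_
  have hq := (hQ (Fin.init y)).1 (y (Fin.last n))
  have hc : 0 < condProb (P φ) y := div_pos (hP φ y) (prefixProb_pos (hP φ) _)
  have hm : 0 < condProb (fun x => ∑ φ, π φ * P φ x) y :=
    div_pos (hM y) (prefixProb_pos hM _)
  rw [Real.log_div hc.ne' hq.ne', Real.log_div hc.ne' hm.ne', Real.log_div hm.ne' hq.ne']
  ring

theorem exists_isPredictor (Y : Type*) [Fintype Y] [Nonempty Y] (n : ℕ) :
    ∃ Q : (Fin n → Y) → Y → ℝ, IsPredictor Q :=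
  ⟨fun _ _ => (Fintype.card Y : ℝ)⁻¹, fun _ => ⟨fun _ => by positivity, by simp⟩⟩

variable {Y F : Type*} [Fintype Y] [Nonempty Y] [Fintype F] [Nonempty F] {n : ℕ}

/-- Theorem 2, lower bound: `C_{c,N}(Θ) ≤ R*_N(Θ, Φ)`, where
`C_{c,N}(Θ)` is the supremum of `I_π(Y_N; Φ | Y^{N-1})` over priors `π`
supported on the index set `G` of `Θ`. -/
theorem capacity_Theta_le_Rstar
    (P : F → (Fin (n + 1) → Y) → ℝ) (hP : ∀ φ, IsModel (P φ))
    (G : Finset F) (hG : G.Nonempty) :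
    sSup {r : ℝ | ∃ π, IsPrior π ∧ (∀ φ ∉ G, π φ = 0) ∧ r = mutualInfoN P π} ≤
      Rstar P G hG := by
  classical
  obtain ⟨g, hg⟩ := hG
  obtain ⟨Q₀, hQ₀⟩ := exists_isPredictor Y n
  refine csSup_le ⟨_, Pi.single g 1, ⟨fun φ => ?_, by simp⟩, fun φ hφ => ?_, rfl⟩ ?_
  · exact (Pi.single_nonneg.2 zero_le_one : (0 : F → ℝ) ≤ Pi.single g 1) φ
  · exact Pi.single_eq_of_ne (ne_of_mem_of_not_mem hg hφ).symm _
  rintro _ ⟨π, hπ, hπG, rfl⟩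
  refine le_csInf ⟨_, Q₀, hQ₀, rfl⟩ ?_
  rintro _ ⟨Q, hQ, rfl⟩
  set R := Finset.univ.sup' Finset.univ_nonempty fun φ =>
    G.sup' ⟨g, hg⟩ fun θ => regretN (P φ) (P θ) Q
  have hR : ∀ φ ∈ G, regretN (P φ) (P φ) Q ≤ R := fun φ hφ =>
    (Finset.le_sup' (fun θ => regretN (P φ) (P θ) Q) hφ).trans
      (Finset.le_sup' (fun φ => G.sup' ⟨g, hg⟩ fun θ => regretN (P φ) (P θ) Q)
        (Finset.mem_univ φ))
  have hpos : ∀ φ y, 0 < P φ y := fun φ => (hP φ).1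
  calc mutualInfoN P π ≤ ∑ φ, π φ * regretN (P φ) (P φ) Q := by
        rw [sum_regretN_eq hpos hπ hQ]
        exact le_add_of_nonneg_right
          (regretN_self_nonneg (fun y => hπ.sum_mul_pos fun φ => hpos φ y) hQ)
    _ ≤ ∑ φ, π φ * R := by
        refine Finset.sum_le_sum fun φ _ => ?_
        by_cases hφ : φ ∈ G
        · exact mul_le_mul_of_nonneg_left (hR φ hφ) (hπ.1 φ)
        · simp [hπG φ hφ]
    _ = R := by rw [← Finset.sum_mul, hπ.2, one_mul]
end
end
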